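/- Let V be a real vector space, M ⊆ V a nonempty convex set whose affine span is all of V, and ≽ a preorder on M satisfying SI, with positive cone C = {λ•(x − y) : λ > 0, x, y ∈ M, x ≽ y}. Then ≽ satisfies CD (countable domination) if and only if there exists a linear subspace Z of V contained in the linear span of C, with Module.rank ℝ Z ≤ ℵ₀, such that Z is cofinal in the linear span of C: for every v in the linear span of C there exists z ∈ Z with z − v ∈ C. -/

import Mathlib

open Cardinal

variable {V : Type*} [AddCommGroup V] [Module ℝ V]

/-- `u : V → ℝ` is mixture preserving on the convex set `M`. -/
def MixPres (M : Set V) (u : V → ℝ) : Prop :=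
  ∀ x ∈ M, ∀ y ∈ M, ∀ α : ℝ, 0 ≤ α → α ≤ 1 →
    u (α • x + (1 - α) • y) = α * u x + (1 - α) * u y

/-- Axiom MR: existence of a mixture-preserving multi-representation of `r` on `M`. -/
def AxMR (M : Set V) (r : V → V → Prop) : Prop :=
  ∃ U : Set (V → ℝ), U.Nonempty ∧ (∀ u ∈ U, MixPres M u) ∧
    ∀ x ∈ M, ∀ y ∈ M, (r x y ↔ ∀ u ∈ U, u x ≥ u y)

/-- Axiom MC (mixture continuity). -/
def AxMC (M : Set V) (r : V → V → Prop) : Prop :=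
  ∀ x ∈ M, ∀ y ∈ M, ∀ z ∈ M,
    (∀ α : ℝ, 0 < α → α ≤ 1 →
      r (α • x + (1 - α) • y) z ∧ ¬ r z (α • x + (1 - α) • y)) →
    r y z

/-- Axiom SI (strong independence). -/
def AxSI (M : Set V) (r : V → V → Prop) : Prop :=
  ∀ x ∈ M, ∀ y ∈ M, ∀ z ∈ M, ∀ α : ℝ, 0 < α → α < 1 →
    (r x y ↔ r (α • x + (1 - α) • z) (α • y + (1 - α) • z))

/-- Axiom CD (countable domination). -/
def AxCD (M : Set V) (r : V → V → Prop) : Prop :=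
  ∃ D : Set (V × V), D.Countable ∧
    (∀ p ∈ D, p.1 ∈ M ∧ p.2 ∈ M ∧ r p.1 p.2) ∧
    ∀ s ∈ M, ∀ t ∈ M, r s t →
      ∃ p ∈ D, ∃ α : ℝ, 0 < α ∧ α < 1 ∧
        r (α • p.1 + (1 - α) • t) (α • p.2 + (1 - α) • s)

/-- Axiom SD (singleton domination). -/
def AxSD (M : Set V) (r : V → V → Prop) : Prop :=
  ∃ x ∈ M, ∃ y ∈ M, r x y ∧
    ∀ s ∈ M, ∀ t ∈ M, r s t →
      ∃ α : ℝ, 0 < α ∧ α < 1 ∧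
        r (α • x + (1 - α) • t) (α • y + (1 - α) • s)

/-- The positive cone of the preorder `r` on `M`. -/
def posCone (M : Set V) (r : V → V → Prop) : Set V :=
  {v | ∃ l : ℝ, 0 < l ∧ ∃ x ∈ M, ∃ y ∈ M, r x y ∧ v = l • (x - y)}

/-- A set is algebraically closed. -/
def AlgClosed (S : Set V) : Prop :=
  ∀ v w : V, (∀ α : ℝ, 0 < α → α ≤ 1 → (1 - α) • v + α • w ∈ S) → v ∈ S

/-- The weak topology on a real vector space: the coarsest topology making all
linear functionals continuous. -/
def weakTop (W : Type*) [AddCommGroup W] [Module ℝ W] : TopologicalSpace W :=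
  ⨅ f : W →ₗ[ℝ] ℝ, TopologicalSpace.induced (⇑f) inferInstance

/-- The linear span of the set of differences of elements of `M`. -/
def diffSpan (M : Set V) : Submodule ℝ V :=
  Submodule.span ℝ {v | ∃ x ∈ M, ∃ y ∈ M, v = x - y}

/-- `u` is strictly increasing for `r` on `M`. -/
def StrIncr (M : Set V) (r : V → V → Prop) (u : V → ℝ) : Prop :=
  (∀ x ∈ M, ∀ y ∈ M, r x y → u x ≥ u y) ∧
  (∀ x ∈ M, ∀ y ∈ M, r x y → ¬ r y x → u x > u y)

theorem AxSI.mix_left {M : Set V} {r : V → V → Prop} (hSI : AxSI M r) {x y z : V}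
    (hx : x ∈ M) (hy : y ∈ M) (hz : z ∈ M) {α : ℝ} (h0 : 0 < α) (h1 : α < 1) :
    r x y ↔ r ((1 - α) • z + α • x) ((1 - α) • z + α • y) := by
  rw [add_comm _ (α • x), add_comm _ (α • y)]
  exact hSI x hx y hy z hz α h0 h1

theorem Convex.mix_mem {M : Set V} (hconv : Convex ℝ M) {x y : V} (hx : x ∈ M) (hy : y ∈ M)
    {α : ℝ} (h0 : 0 < α) (h1 : α < 1) : α • x + (1 - α) • y ∈ M :=
  hconv hx hy h0.le (by linarith) (by ring)

theorem sub_mem_posCone {M : Set V} {r : V → V → Prop} {x y : V}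
    (hx : x ∈ M) (hy : y ∈ M) (h : r x y) : x - y ∈ posCone M r :=
  ⟨1, one_pos, x, hx, y, hy, h, (one_smul ℝ _).symm⟩

theorem rel_of_sub_mem_posCone {M : Set V} {r : V → V → Prop}
    (hSI : AxSI M r) {x y : V} (hx : x ∈ M) (hy : y ∈ M) (h : x - y ∈ posCone M r) :
    r x y := by
  obtain ⟨l, hl, s, hs, t, ht, hst, he⟩ := h
  have hl1 : (0 : ℝ) < 1 + l := by linarith
  have h0 : 0 < 1 / (1 + l) := by positivity
  have h1 : 1 / (1 + l) < 1 := by rw [div_lt_one hl1]; linarith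
  rw [hSI x hx y hy t ht _ h0 h1]
  have hx' : x = y + l • (s - t) := by rw [← he]; abel
  have key : (1 / (1 + l)) • x + (1 - 1 / (1 + l)) • t
      = (1 - (1 - 1 / (1 + l))) • y + (1 - 1 / (1 + l)) • s := by
    rw [hx']
    match_scalars <;> field_simp <;> ring
  have hy' : (1 / (1 + l)) • y + (1 - 1 / (1 + l)) • t
      = (1 - (1 - 1 / (1 + l))) • y + (1 - 1 / (1 + l)) • t := by
    rw [sub_sub_cancel]
  rw [key, hy']
  exact (hSI.mix_left hs ht hy (by linarith) (by linarith)).1 hst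

theorem posCone_add_mem {M : Set V} (hconv : Convex ℝ M) {r : V → V → Prop}
    (htrans : ∀ x ∈ M, ∀ y ∈ M, ∀ z ∈ M, r x y → r y z → r x z) (hSI : AxSI M r)
    {v w : V} (hv : v ∈ posCone M r) (hw : w ∈ posCone M r) : v + w ∈ posCone M r := by
  obtain ⟨l, hl, s, hs, t, ht, hst, rfl⟩ := hv
  obtain ⟨m, hm, x, hx, y, hy, hxy, rfl⟩ := hw
  have hlm : 0 < l + m := by linarith
  have h0 : 0 < l / (l + m) := by positivity
  have h1 : l / (l + m) < 1 := by rw [div_lt_one hlm]; linarith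
  refine ⟨l + m, hlm, (l / (l + m)) • s + (1 - l / (l + m)) • x, hconv.mix_mem hs hx h0 h1,
    (l / (l + m)) • t + (1 - l / (l + m)) • y, hconv.mix_mem ht hy h0 h1, ?_, ?_⟩
  · refine htrans _ (hconv.mix_mem hs hx h0 h1) _ (hconv.mix_mem ht hx h0 h1) _
      (hconv.mix_mem ht hy h0 h1) ((hSI s hs t ht x hx _ h0 h1).1 hst) ?_
    have := (hSI.mix_left hx hy ht (α := 1 - l / (l + m)) (by linarith) (by linarith)).1 hxy
    rwa [sub_sub_cancel] at this
  · match_scalars <;> field_simp <;> ring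

/-- The positive cone of a strongly independent preorder, as a pointed cone. -/
def posPointedCone (M : Set V) (hM : M.Nonempty) (hconv : Convex ℝ M) (r : V → V → Prop)
    (hrefl : ∀ x ∈ M, r x x)
    (htrans : ∀ x ∈ M, ∀ y ∈ M, ∀ z ∈ M, r x y → r y z → r x z) (hSI : AxSI M r) :
    PointedCone ℝ V where
  carrier := posCone M r
  add_mem' := posCone_add_mem hconv htrans hSI
  zero_mem' := by
    obtain ⟨x, hx⟩ := hM
    simpa using sub_mem_posCone hx hx (hrefl x hx)
  smul_mem' := by
    rintro ⟨c, hc⟩ v ⟨l, hl, x, hx, y, hy, hxy, rfl⟩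
    rcases hc.eq_or_lt with rfl | hc'
    · exact ⟨1, one_pos, x, hx, x, hx, hrefl x hx, by simp⟩
    · exact ⟨c * l, mul_pos hc' hl, x, hx, y, hy, hxy, by
        rw [mul_smul]; rfl⟩

theorem PointedCone.exists_eq_sub_of_mem_span (C : PointedCone ℝ V) {v : V}
    (hv : v ∈ Submodule.span ℝ (C : Set V)) : ∃ c ∈ C, ∃ d ∈ C, v = c - d := by
  induction hv using Submodule.span_induction with
  | mem x h => exact ⟨x, h, 0, C.zero_mem, by simp⟩
  | zero => exact ⟨0, C.zero_mem, 0, C.zero_mem, by simp⟩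
  | add x y _ _ hx hy =>
    obtain ⟨c, hc, d, hd, rfl⟩ := hx
    obtain ⟨c', hc', d', hd', rfl⟩ := hy
    exact ⟨c + c', C.add_mem hc hc', d + d', C.add_mem hd hd', by abel⟩
  | smul a x _ hx =>
    obtain ⟨c, hc, d, hd, rfl⟩ := hx
    rcases le_total 0 a with ha | ha
    · exact ⟨a • c, C.smul_mem ha hc, a • d, C.smul_mem ha hd, smul_sub _ _ _⟩
    · exact ⟨(-a) • d, C.smul_mem (by linarith) hd, (-a) • c,
        C.smul_mem (by linarith) hc, by module⟩

/-- A subspace of countable dimension inside the span of a cone is dominated, up to positive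
scaling, by a countable subset of the cone. -/
theorem PointedCone.exists_countable_dominating (C : PointedCone ℝ V) (Z : Submodule ℝ V)
    (hZ : Z ≤ Submodule.span ℝ (C : Set V)) (hrank : Module.rank ℝ Z ≤ aleph0) :
    ∃ E : Set V, E.Countable ∧ E ⊆ C ∧
      ∀ z ∈ Z, ∃ e ∈ E, ∃ n : ℝ, 0 < n ∧ n • e - z ∈ C := by
  let b := Module.Basis.ofVectorSpace ℝ Z
  have hcount : Countable (Module.Basis.ofVectorSpaceIndex ℝ Z) := by
    rw [← Cardinal.mk_le_aleph0_iff, b.mk_eq_rank'']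
    exact hrank
  choose c hc d hd hcd using fun i => C.exists_eq_sub_of_mem_span (hZ (b i).2)
  refine ⟨Set.range fun F : Finset (Module.Basis.ofVectorSpaceIndex ℝ Z) =>
    ∑ i ∈ F, (c i + d i), Set.countable_range _, ?_, fun z hz => ?_⟩
  · rintro _ ⟨F, rfl⟩
    exact C.sum_mem fun i _ => C.add_mem (hc i) (hd i)
  · set a := b.repr ⟨z, hz⟩ with ha
    have hz' : z = ∑ i ∈ a.support, a i • (b i : V) := by
      have h := congrArg Subtype.val (b.linearCombination_repr ⟨z, hz⟩)
      rw [Finsupp.linearCombination_apply, Finsupp.sum] at h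
      simpa using h.symm
    have hn : 0 ≤ ∑ i ∈ a.support, |a i| := Finset.sum_nonneg fun i _ => abs_nonneg _
    refine ⟨_, ⟨a.support, rfl⟩, 1 + ∑ i ∈ a.support, |a i|, by linarith, ?_⟩
    rw [hz', Finset.smul_sum, ← Finset.sum_sub_distrib]
    refine C.sum_mem fun i hi => ?_
    have hle : |a i| ≤ ∑ i ∈ a.support, |a i| :=
      Finset.single_le_sum (f := fun i => |a i|) (fun i _ => abs_nonneg _) hi
    have h := abs_le.1 hle
    rw [hcd i]
    generalize ∑ i ∈ a.support, |a i| = n at h hn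
    have he : (1 + n) • (c i + d i) - a i • (c i - d i)
        = (1 + n - a i) • c i + (1 + n + a i) • d i := by module
    rw [he]
    exact C.add_mem (C.smul_mem (by linarith) (hc i))
      (C.smul_mem (by linarith) (hd i))

theorem stmt_11 (M : Set V) (hM : M.Nonempty) (hconv : Convex ℝ M)
    (haff : affineSpan ℝ M = ⊤)
    (r : V → V → Prop) (hrefl : ∀ x ∈ M, r x x)
    (htrans : ∀ x ∈ M, ∀ y ∈ M, ∀ z ∈ M, r x y → r y z → r x z)
    (hSI : AxSI M r) :
    AxCD M r ↔
      ∃ Z : Submodule ℝ V, Z ≤ Submodule.span ℝ (posCone M r) ∧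
        Module.rank ℝ ↥Z ≤ aleph0 ∧
        ∀ v ∈ Submodule.span ℝ (posCone M r), ∃ z ∈ Z, z - v ∈ posCone M r := by
  let C : PointedCone ℝ V := posPointedCone M hM hconv r hrefl htrans hSI
  constructor
  · rintro ⟨D, hD, hDM, hdom⟩
    refine ⟨Submodule.span ℝ ((fun p : V × V => p.1 - p.2) '' D), ?_, ?_, fun v hv => ?_⟩
    · refine Submodule.span_mono ?_
      rintro _ ⟨p, hp, rfl⟩
      obtain ⟨h1, h2, h⟩ := hDM p hp
      exact sub_mem_posCone h1 h2 h
    · exact (rank_span_le _).trans (Cardinal.le_aleph0_iff_set_countable.2 (hD.image _))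
    · obtain ⟨c, ⟨l, hl, s, hs, t, ht, hst, rfl⟩, d, hd, rfl⟩ :=
        C.exists_eq_sub_of_mem_span hv
      obtain ⟨p, hp, α, h0, h1, h⟩ := hdom s hs t ht hst
      obtain ⟨hp1, hp2, -⟩ := hDM p hp
      have hα : 0 < 1 - α := by linarith
      have hmem : (α • p.1 + (1 - α) • t) - (α • p.2 + (1 - α) • s) ∈ C :=
        sub_mem_posCone (hconv.mix_mem hp1 ht h0 h1) (hconv.mix_mem hp2 hs h0 h1) h
      refine ⟨(l / (1 - α) * α) • (p.1 - p.2),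
        Submodule.smul_mem _ _ (Submodule.subset_span ⟨p, hp, rfl⟩), ?_⟩
      have he : (l / (1 - α) * α) • (p.1 - p.2) - (l • (s - t) - d)
          = (l / (1 - α)) • ((α • p.1 + (1 - α) • t) - (α • p.2 + (1 - α) • s)) + d := by
        match_scalars <;> field_simp
      rw [he]
      exact C.add_mem (C.smul_mem (by positivity) hmem) hd
  · rintro ⟨Z, hZ, hrank, hcof⟩
    obtain ⟨E, hE, hEC, hdom⟩ := C.exists_countable_dominating Z hZ hrank
    have hrep : ∀ e : E, ∃ p : V × V, (p.1 ∈ M ∧ p.2 ∈ M ∧ r p.1 p.2) ∧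
        ∃ l : ℝ, 0 < l ∧ (e : V) = l • (p.1 - p.2) := by
      rintro ⟨e, he⟩
      obtain ⟨l, hl, x, hx, y, hy, hxy, h⟩ := hEC he
      exact ⟨(x, y), ⟨hx, hy, hxy⟩, l, hl, h⟩
    choose p hp l hl hpl using hrep
    have := hE.to_subtype
    refine ⟨Set.range p, Set.countable_range p, ?_, fun s hs t ht hst => ?_⟩
    · rintro _ ⟨e, rfl⟩
      exact hp e
    · obtain ⟨z, hz, hzC⟩ := hcof (s - t) (Submodule.subset_span (sub_mem_posCone hs ht hst))
      obtain ⟨e, he, n, hn, hnC⟩ := hdom z hz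
      obtain ⟨hp1, hp2, -⟩ := hp ⟨e, he⟩
      have hm : 0 < n * l ⟨e, he⟩ := mul_pos hn (hl _)
      have hsum : (n * l ⟨e, he⟩) • ((p ⟨e, he⟩).1 - (p ⟨e, he⟩).2) - (s - t) ∈ C := by
        have h := C.add_mem hnC hzC
        rwa [sub_add_sub_cancel, show e = _ from hpl ⟨e, he⟩, smul_smul] at h
      generalize n * l ⟨e, he⟩ = m at hm hsum
      have h0 : 0 < m / (1 + m) := by positivity
      have h1 : m / (1 + m) < 1 := by rw [div_lt_one (by linarith)]; linarith
      refine ⟨_, ⟨⟨e, he⟩, rfl⟩, m / (1 + m), h0, h1,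
        rel_of_sub_mem_posCone hSI (hconv.mix_mem hp1 ht h0 h1)
          (hconv.mix_mem hp2 hs h0 h1) ?_⟩
      have h : (1 / (1 + m)) • (m • ((p ⟨e, he⟩).1 - (p ⟨e, he⟩).2) - (s - t)) ∈ posCone M r :=
        C.smul_mem (by positivity) hsum
      convert h using 1
      match_scalars <;> field_simp <;> ring
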